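/- Let 0 < α ≤ 1. Then for every t ≥ 0, 0 < E_α(-t^α) ≤ 1. -/

import Mathlib

/-- The one-parameter Mittag-Leffler function `E_α(x) = ∑ xⁿ / Γ(αn + 1)`. -/
noncomputable def mittagLeffler (α x : ℝ) : ℝ :=
  ∑' n : ℕ, x ^ n / Real.Gamma (α * n + 1)

open MeasureTheory Set Filter Topology

theorem rpow_mul_exp_neg_le_Gamma {M x : ℝ} (hM : 0 < M) (hx : 0 ≤ x) :
    M ^ x * Real.exp (-M) ≤ Real.Gamma (x + 1) := by
  have hint := Real.GammaIntegral_convergent (s := x + 1) (by linarith)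
  have hsub : Ioi M ⊆ Ioi (0 : ℝ) := Ioi_subset_Ioi hM.le
  rw [Real.Gamma_eq_integral (by linarith : 0 < x + 1), ← integral_exp_neg_Ioi,
    ← integral_const_mul]
  refine (setIntegral_mono_on ((integrableOn_exp_neg_Ioi M).const_mul _) (hint.mono_set hsub)
    measurableSet_Ioi fun y hy => ?_).trans
    (setIntegral_mono_set hint ?_ hsub.eventuallyLE)
  · rw [mul_comm, add_sub_cancel_right]
    gcongr
    exact le_of_lt hy
  · filter_upwards [ae_restrict_mem measurableSet_Ioi] with y hy
    have : (0 : ℝ) < y := hy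
    simp only [Pi.zero_apply]
    positivity

theorem summable_pow_div_Gamma {α : ℝ} (hα : 0 < α) (R : ℝ) :
    Summable fun n : ℕ => R ^ n / Real.Gamma (α * n + 1) := by
  set M : ℝ := (2 * |R| + 1) ^ α⁻¹
  have hR : 0 < 2 * |R| + 1 := by positivity
  have hM : 0 < M := by positivity
  have hMα : M ^ α = 2 * |R| + 1 := by
    rw [← Real.rpow_mul hR.le, inv_mul_cancel₀ hα.ne', Real.rpow_one]
  refine Summable.of_norm_bounded (g := fun n : ℕ => Real.exp M * (1 / 2) ^ n)
    ((summable_geometric_of_lt_one (by norm_num) (by norm_num)).mul_left _) fun n => ?_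
  have hn : 0 ≤ α * n := by positivity
  have hG : 0 < Real.Gamma (α * n + 1) := Real.Gamma_pos_of_pos (by linarith)
  have h := rpow_mul_exp_neg_le_Gamma hM hn
  rw [Real.rpow_mul hM.le, Real.rpow_natCast, hMα, Real.exp_neg, ← div_eq_mul_inv,
    div_le_iff₀ (Real.exp_pos M)] at h
  rw [norm_div, norm_pow, Real.norm_eq_abs, Real.norm_of_nonneg hG.le, div_le_iff₀ hG]
  calc |R| ^ n = (1 / 2) ^ n * (2 * |R|) ^ n := by rw [← mul_pow]; ring_nf
    _ ≤ (1 / 2) ^ n * (2 * |R| + 1) ^ n := by gcongr; linarith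
    _ ≤ (1 / 2) ^ n * (Real.Gamma (α * n + 1) * Real.exp M) := by gcongr
    _ = _ := by ring

theorem differentiable_mittagLeffler {α : ℝ} (hα : 0 < α) :
    Differentiable ℝ (mittagLeffler α) := by
  intro x
  set R : ℝ := |x| + 1
  have hR : 1 ≤ R := le_add_of_nonneg_left (abs_nonneg x)
  have hx : x ∈ Ioo (-R) R := abs_lt.mp (lt_add_one |x|)
  refine (hasDerivAt_tsum_of_isPreconnected (y₀ := x)
    (g' := fun (n : ℕ) y => (n * y ^ (n - 1)) / Real.Gamma (α * n + 1))
    (summable_pow_div_Gamma hα (2 * R)) isOpen_Ioo isPreconnected_Ioo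
    (fun n y _ => (hasDerivAt_pow n y).div_const _) (fun n y hy => ?_) hx
    (summable_pow_div_Gamma hα x) hx).differentiableAt
  have hG : 0 < Real.Gamma (α * n + 1) := Real.Gamma_pos_of_pos (by positivity)
  rw [norm_div, norm_mul, norm_pow, Real.norm_of_nonneg hG.le, Real.norm_natCast,
    Real.norm_eq_abs, mul_pow]
  gcongr
  · exact_mod_cast Nat.lt_two_pow_self.le
  · exact (pow_le_pow_left₀ (abs_nonneg y) (abs_lt.mpr hy).le _).trans
      (pow_le_pow_right₀ hR (Nat.sub_le n 1))

theorem integral_rpow_mul_sub_rpow {a b t : ℝ} (ha : 0 < a) (hb : 0 < b) (ht : 0 < t) :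
    ∫ s in (0 : ℝ)..t, s ^ (a - 1) * (t - s) ^ (b - 1) =
      t ^ (a + b - 1) * (Real.Gamma a * Real.Gamma b / Real.Gamma (a + b)) := by
  have h := Complex.betaIntegral_scaled (a : ℂ) (b : ℂ) ht
  rw [Complex.betaIntegral_eq_Gamma_mul_div _ _ (by simpa) (by simpa)] at h
  apply Complex.ofReal_injective
  rw [← intervalIntegral.integral_ofReal]
  push_cast [Complex.ofReal_cpow ht.le, ← Complex.Gamma_ofReal]
  rw [← h]
  refine intervalIntegral.integral_congr fun s hs => ?_
  rw [uIcc_of_le ht.le] at hs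
  rw [Complex.ofReal_cpow hs.1, Complex.ofReal_cpow (sub_nonneg.2 hs.2)]
  push_cast
  rfl

theorem intervalIntegrable_sub_rpow {b : ℝ} (hb : 0 < b) (t x y : ℝ) :
    IntervalIntegrable (fun s : ℝ => (t - s) ^ (b - 1)) volume x y := by
  have := (intervalIntegral.intervalIntegrable_rpow' (a := t - x) (b := t - y) (r := b - 1)
    (by linarith)).comp_sub_left t
  simpa using this

theorem continuous_mittagLeffler_neg_rpow {α : ℝ} (hα : 0 < α) :
    Continuous fun s : ℝ => mittagLeffler α (-(s ^ α)) :=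
  (differentiable_mittagLeffler hα).continuous.comp (Real.continuous_rpow_const hα.le).neg

/-- Termwise fractional integration of `s ↦ E_α(-s^α)`. -/
theorem hasSum_integral_sub_rpow_mul_mittagLeffler {α b t : ℝ} (hα : 0 < α) (hb : 0 < b)
    (ht : 0 < t) :
    HasSum (fun n : ℕ => (-1) ^ n * (t ^ (α * n + b) * Real.Gamma b / Real.Gamma (α * n + 1 + b)))
      (∫ s in (0 : ℝ)..t, (t - s) ^ (b - 1) * mittagLeffler α (-(s ^ α))) := by
  have key : HasSum (fun n : ℕ => ∫ s in (0 : ℝ)..t,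
        (t - s) ^ (b - 1) * ((-(s ^ α)) ^ n / Real.Gamma (α * n + 1)))
      (∫ s in (0 : ℝ)..t, (t - s) ^ (b - 1) * mittagLeffler α (-(s ^ α))) := by
    refine intervalIntegral.hasSum_integral_of_dominated_convergence
      (fun n s => (t - s) ^ (b - 1) * ((t ^ α) ^ n / Real.Gamma (α * n + 1))) ?_ ?_ ?_ ?_ ?_
    · intro n
      refine Measurable.aestronglyMeasurable ?_
      fun_prop
    · refine fun n => ae_of_all _ fun s hs => ?_
      rw [uIoc_of_le ht.le] at hs
      have hG : 0 < Real.Gamma (α * n + 1) := Real.Gamma_pos_of_pos (by positivity)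
      have hts : 0 ≤ t - s := sub_nonneg.2 hs.2
      have hs0 : 0 ≤ s := hs.1.le
      rw [norm_mul, norm_div, norm_pow, norm_neg, Real.norm_of_nonneg hG.le,
        Real.norm_of_nonneg (by positivity), Real.norm_of_nonneg (by positivity)]
      gcongr
      exact hs.2
    · exact ae_of_all _ fun s _ => (summable_pow_div_Gamma hα _).mul_left _
    · simp_rw [tsum_mul_left]
      exact (intervalIntegrable_sub_rpow hb t 0 t).mul_const _
    · exact ae_of_all _ fun s _ => (summable_pow_div_Gamma hα _).hasSum.mul_left _
  convert key using 2 with n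
  have hG : Real.Gamma (α * n + 1) ≠ 0 := (Real.Gamma_pos_of_pos (by positivity)).ne'
  have h := integral_rpow_mul_sub_rpow (a := α * n + 1) (by positivity) hb ht
  have hc : ∫ s in (0 : ℝ)..t, (t - s) ^ (b - 1) * ((-(s ^ α)) ^ n / Real.Gamma (α * n + 1)) =
      ∫ s in (0 : ℝ)..t, ((-1) ^ n / Real.Gamma (α * n + 1)) *
        (s ^ (α * n + 1 - 1) * (t - s) ^ (b - 1)) := by
    refine intervalIntegral.integral_congr fun s hs => ?_
    rw [uIcc_of_le ht.le] at hs
    rw [add_sub_cancel_right, Real.rpow_mul hs.1, Real.rpow_natCast, neg_pow]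
    ring
  rw [hc, intervalIntegral.integral_const_mul, h, show α * n + 1 + b - 1 = α * n + b by ring]
  field_simp

/-- The Volterra equation solved by `E_α(-t^α)`. -/
theorem integral_sub_rpow_mul_mittagLeffler_eq {α t : ℝ} (hα : 0 < α) (ht : 0 < t) :
    ∫ s in (0 : ℝ)..t, (t - s) ^ (α - 1) * mittagLeffler α (-(s ^ α)) =
      Real.Gamma α * (1 - mittagLeffler α (-(t ^ α))) := by
  rw [← (hasSum_integral_sub_rpow_mul_mittagLeffler hα hα ht).tsum_eq, mittagLeffler,
    (summable_pow_div_Gamma hα (-(t ^ α))).tsum_eq_zero_add]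
  simp only [pow_zero, Nat.cast_zero, mul_zero, zero_add, Real.Gamma_one, div_one,
    sub_add_cancel_left]
  rw [← tsum_neg, ← tsum_mul_left]
  refine tsum_congr fun n => ?_
  rw [neg_pow (t ^ α), ← Real.rpow_natCast (t ^ α), ← Real.rpow_mul ht.le]
  push_cast
  rw [pow_succ, show α * n + 1 + α = α * (n + 1) + 1 by ring,
    show α * n + α = α * (n + 1) by ring]
  ring

/-- The relaxation equation with Caputo derivative, integrated once. -/
theorem integral_sub_rpow_neg_mul_mittagLeffler_eq {α t : ℝ} (hα : 0 < α) (hα1 : α < 1)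
    (ht : 0 < t) :
    ∫ s in (0 : ℝ)..t, (t - s) ^ (-α) * mittagLeffler α (-(s ^ α)) =
      t ^ (1 - α) / (1 - α) -
        Real.Gamma (1 - α) * ∫ s in (0 : ℝ)..t, mittagLeffler α (-(s ^ α)) := by
  have hb : 0 < 1 - α := sub_pos.2 hα1
  have h₁ := hasSum_integral_sub_rpow_mul_mittagLeffler hα hb ht
  have h₂ := hasSum_integral_sub_rpow_mul_mittagLeffler hα one_pos ht
  simp only [sub_self, Real.rpow_zero, one_mul, Real.Gamma_one, mul_one] at h₂
  rw [show 1 - α - 1 = -α by ring] at h₁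
  rw [← h₁.tsum_eq, ← h₂.tsum_eq, h₁.summable.tsum_eq_zero_add, ← tsum_mul_left,
    sub_eq_add_neg (t ^ (1 - α) / _), ← tsum_neg]
  congr 1
  · simp only [pow_zero, Nat.cast_zero, mul_zero, zero_add, one_mul]
    rw [add_comm 1 (1 - α), Real.Gamma_add_one hb.ne']
    have := (Real.Gamma_pos_of_pos hb).ne'
    field_simp
  · refine tsum_congr fun n => ?_
    push_cast
    rw [pow_succ, show α * (n + 1) + 1 + (1 - α) = α * n + 1 + 1 by ring,
      show α * (n + 1) + (1 - α) = α * n + 1 by ring]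
    ring

/-- At a first zero the increment of the Caputo integral contradicts a linear bound. -/
theorem mittagLeffler_neg_rpow_ne_zero_of_pos {α t : ℝ} (hα : 0 < α) (hα1 : α < 1) (ht : 0 < t)
    (hpos : ∀ s, 0 ≤ s → s < t → 0 < mittagLeffler α (-(s ^ α))) :
    mittagLeffler α (-(t ^ α)) ≠ 0 := by
  intro h0
  have hb : 0 < 1 - α := sub_pos.2 hα1
  set u : ℝ → ℝ := fun s => mittagLeffler α (-(s ^ α))
  have hcont : Continuous u := continuous_mittagLeffler_neg_rpow hα
  have hnn : ∀ s, 0 ≤ s → s ≤ t → 0 ≤ u s := fun s hs hst => by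
    rcases hst.eq_or_lt with rfl | h
    · exact h0.ge
    · exact (hpos s hs h).le
  have hdiff : DifferentiableAt ℝ u t :=
    (differentiable_mittagLeffler hα _).comp t
      (Real.differentiableAt_rpow_const_of_ne α ht.ne').neg
  obtain ⟨C, hC0, hC⟩ := hdiff.hasDerivAt.isBigO_sub.exists_pos
  obtain ⟨δ, hδ, hCδ⟩ := Metric.eventually_nhds_iff.1 hC.bound
  have hker : ∀ t' x y : ℝ, IntervalIntegrable (fun s => (t' - s) ^ (-α) * u s) volume x y :=
    fun t' x y => by
      have := intervalIntegrable_sub_rpow hb t' x y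
      rw [show 1 - α - 1 = -α by ring] at this
      exact this.mul_continuousOn hcont.continuousOn
  have hΓ := Real.Gamma_pos_of_pos hb
  have main : ∀ h, 0 < h → h < t → h < δ →
      t ^ (-α) ≤ C / (1 - α) * h ^ (1 - α) + Real.Gamma (1 - α) * C * h := by
    intro h hh hht hhδ
    have hth : 0 < t - h := sub_pos.2 hht
    have hlin : ∀ s ∈ Icc (t - h) t, u s ≤ C * h := fun s hs => by
      have := hCδ (y := s) (by
        rw [Real.dist_eq, abs_sub_comm, abs_of_nonneg (sub_nonneg.2 hs.2)]; linarith [hs.1])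
      simp only [Real.norm_eq_abs] at this
      rw [show u t = 0 from h0, sub_zero, abs_sub_comm s t,
        abs_of_nonneg (sub_nonneg.2 hs.2)] at this
      refine (le_abs_self _).trans (this.trans ?_)
      gcongr
      linarith [hs.1]
    have e₁ := integral_sub_rpow_neg_mul_mittagLeffler_eq hα hα1 ht
    have e₂ := integral_sub_rpow_neg_mul_mittagLeffler_eq hα hα1 hth
    rw [← intervalIntegral.integral_add_adjacent_intervals (hker t 0 (t - h))
      (hker t (t - h) t), ← intervalIntegral.integral_add_adjacent_intervals
      (hcont.intervalIntegrable 0 (t - h)) (hcont.intervalIntegrable (t - h) t)] at e₁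
    have i₁ : ∫ s in (0 : ℝ)..(t - h), (t - s) ^ (-α) * u s ≤
        ∫ s in (0 : ℝ)..(t - h), (t - h - s) ^ (-α) * u s := by
      refine intervalIntegral.integral_mono_on_of_le_Ioo hth.le (hker _ _ _) (hker _ _ _)
        fun s hs => ?_
      have hs' : 0 < t - h - s := sub_pos.2 hs.2
      refine mul_le_mul_of_nonneg_right ?_ (hnn s hs.1.le (by linarith))
      exact Real.rpow_le_rpow_of_nonpos hs' (by linarith) (by linarith)
    have i₂ : ∫ s in (t - h)..t, (t - s) ^ (-α) * u s ≤ h ^ (1 - α) / (1 - α) * (C * h) := by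
      have hk := intervalIntegrable_sub_rpow hb t (t - h) t
      rw [show 1 - α - 1 = -α by ring] at hk
      calc ∫ s in (t - h)..t, (t - s) ^ (-α) * u s
          ≤ ∫ s in (t - h)..t, (t - s) ^ (-α) * (C * h) := by
            refine intervalIntegral.integral_mono_on (by linarith) (hker _ _ _)
              (hk.mul_const _) fun s hs => ?_
            exact mul_le_mul_of_nonneg_left (hlin s hs)
              (Real.rpow_nonneg (sub_nonneg.2 hs.2) _)
        _ = h ^ (1 - α) / (1 - α) * (C * h) := by
            rw [intervalIntegral.integral_mul_const,
              intervalIntegral.integral_comp_sub_left (fun x => x ^ (-α)) t,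
              integral_rpow (Or.inl (by linarith)), sub_self, sub_sub_cancel,
              show -α + 1 = 1 - α by ring, Real.zero_rpow hb.ne', sub_zero]
    have i₃ : ∫ s in (t - h)..t, u s ≤ h * (C * h) := by
      calc ∫ s in (t - h)..t, u s ≤ ∫ _ in (t - h)..t, C * h :=
            intervalIntegral.integral_mono_on (by linarith) (hcont.intervalIntegrable _ _)
              intervalIntegrable_const hlin
        _ = h * (C * h) := by
            rw [intervalIntegral.integral_const, sub_sub_cancel, smul_eq_mul]
    have i₄ : (1 - α) * (t ^ (-α) * h) ≤ t ^ (1 - α) - (t - h) ^ (1 - α) := by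
      have hb' := rpow_one_add_le_one_add_mul_self (s := -(h / t)) (p := 1 - α)
        (by rw [neg_le_neg_iff, div_le_one ht]; exact hht.le) hb.le (by linarith)
      have hsplit : (t - h) ^ (1 - α) = t ^ (1 - α) * (1 + -(h / t)) ^ (1 - α) := by
        rw [← Real.mul_rpow ht.le]
        · congr 1; field_simp; ring
        · rw [← sub_eq_add_neg, sub_nonneg, div_le_one ht]; exact hht.le
      have ht1 : t ^ (1 - α) = t * t ^ (-α) := by
        rw [sub_eq_add_neg, Real.rpow_add ht, Real.rpow_one]
      have := mul_le_mul_of_nonneg_left hb' (Real.rpow_nonneg ht.le (1 - α))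
      rw [← hsplit] at this
      have hr : t ^ (1 - α) * (1 + (1 - α) * -(h / t)) =
          t ^ (1 - α) - (1 - α) * (t ^ (-α) * h) := by
        rw [ht1]; field_simp; ring
      linarith
    have i₅ : t ^ (-α) * h ≤ t ^ (1 - α) / (1 - α) - (t - h) ^ (1 - α) / (1 - α) := by
      rw [← sub_div, le_div_iff₀ hb]; linarith
    have i₆ := mul_le_mul_of_nonneg_left i₃ hΓ.le
    have : t ^ (-α) * h ≤
        (C / (1 - α) * h ^ (1 - α) + Real.Gamma (1 - α) * C * h) * h := by
      have r : (C / (1 - α) * h ^ (1 - α) + Real.Gamma (1 - α) * C * h) * h =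
        h ^ (1 - α) / (1 - α) * (C * h) + Real.Gamma (1 - α) * (h * (C * h)) := by ring
      rw [r]
      linarith
    exact le_of_mul_le_mul_right this hh
  have hlim : Tendsto (fun h : ℝ => C / (1 - α) * h ^ (1 - α) + Real.Gamma (1 - α) * C * h)
      (𝓝[>] 0) (𝓝 0) := by
    have hc : Continuous fun h : ℝ =>
        C / (1 - α) * h ^ (1 - α) + Real.Gamma (1 - α) * C * h :=
      ((Real.continuous_rpow_const hb.le).const_mul _).add (continuous_const.mul continuous_id)
    have := hc.tendsto 0
    rw [Real.zero_rpow hb.ne', mul_zero, mul_zero, add_zero] at this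
    exact this.mono_left nhdsWithin_le_nhds
  have hle : t ^ (-α) ≤ 0 := ge_of_tendsto hlim (by
    filter_upwards [Ioo_mem_nhdsGT (lt_min ht hδ)] with h hh
    exact main h hh.1 (hh.2.trans_le (min_le_left _ _)) (hh.2.trans_le (min_le_right _ _)))
  exact absurd hle (Real.rpow_pos_of_pos ht _).not_ge

theorem mittagLeffler_zero (α : ℝ) : mittagLeffler α 0 = 1 := by
  rw [mittagLeffler, tsum_eq_single 0 fun n hn => by simp [hn]]
  simp

theorem mittagLeffler_one (x : ℝ) : mittagLeffler 1 x = Real.exp x := by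
  simp [mittagLeffler, Real.exp_eq_exp_ℝ, NormedSpace.exp_eq_tsum_div, Real.Gamma_nat_eq_factorial]

theorem mittagLeffler_neg_rpow_pos {α : ℝ} (hα : 0 < α) (hα1 : α ≤ 1) {t : ℝ} (ht : 0 ≤ t) :
    0 < mittagLeffler α (-(t ^ α)) := by
  rcases hα1.eq_or_lt with rfl | hα1
  · rw [mittagLeffler_one]
    exact Real.exp_pos _
  have hcont := continuous_mittagLeffler_neg_rpow hα
  by_contra! hneg
  set S : Set ℝ := {s | 0 ≤ s ∧ mittagLeffler α (-(s ^ α)) ≤ 0}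
  have hS : IsClosed S := isClosed_Ici.inter (isClosed_le hcont continuous_const)
  have hbdd : BddBelow S := ⟨0, fun s hs => hs.1⟩
  obtain ⟨h0, hle⟩ : sInf S ∈ S := hS.csInf_mem ⟨t, ht, hneg⟩ hbdd
  have hpos : ∀ s, 0 ≤ s → s < sInf S → 0 < mittagLeffler α (-(s ^ α)) := fun s hs hlt =>
    not_le.1 fun h => notMem_of_lt_csInf hlt hbdd ⟨hs, h⟩
  have hinf : 0 < sInf S := by
    refine h0.lt_of_ne fun h => ?_
    rw [← h, Real.zero_rpow hα.ne', neg_zero, mittagLeffler_zero] at hle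
    linarith
  refine mittagLeffler_neg_rpow_ne_zero_of_pos hα hα1 hinf hpos (hle.antisymm ?_)
  refine ge_of_tendsto ((hcont.tendsto (sInf S)).mono_left (nhdsWithin_le_nhds (s := Iio (sInf S)))) ?_
  filter_upwards [Ioo_mem_nhdsLT hinf] with s hs
  exact (hpos s hs.1.le hs.2).le

/-- For `0 < α ≤ 1` and `t ≥ 0`, `0 < E_α(-t^α) ≤ 1`. -/
theorem mittagLeffler_pos_le_one
    (α : ℝ) (hα0 : 0 < α) (hα1 : α ≤ 1) :
    ∀ t : ℝ, 0 ≤ t →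
      0 < mittagLeffler α (-(t ^ α)) ∧ mittagLeffler α (-(t ^ α)) ≤ 1 := by
  intro t ht
  refine ⟨mittagLeffler_neg_rpow_pos hα0 hα1 ht, ?_⟩
  rcases ht.eq_or_lt with rfl | ht
  · rw [Real.zero_rpow hα0.ne', neg_zero, mittagLeffler_zero]
  have h := integral_sub_rpow_mul_mittagLeffler_eq hα0 ht
  have hnn : 0 ≤ ∫ s in (0 : ℝ)..t, (t - s) ^ (α - 1) * mittagLeffler α (-(s ^ α)) :=
    intervalIntegral.integral_nonneg ht.le fun s hs =>
      mul_nonneg (Real.rpow_nonneg (sub_nonneg.2 hs.2) _)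
        (mittagLeffler_neg_rpow_pos hα0 hα1 hs.1).le
  rw [h] at hnn
  exact sub_nonneg.1 (nonneg_of_mul_nonneg_right hnn (Real.Gamma_pos_of_pos hα0))
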